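/- Let R, S and T be triangulated categories with a left recollement given by triangle functors i^* : S → R, i_* : R → S, j_! : T → S, j^* : S → T, and let G_R ∈ R, G_S ∈ S. If i^*(G_S) ∈ ⟨G_R⟩, then fd(R, G_R) ≤ fd(S, G_S) + w_{G_R}(i^*(G_S)). In particular, if fd(S, G_S) is finite, then so is fd(R, G_R). -/

import Mathlib

/-! Core definitions for homological dimensions in triangulated categories,
following Chen–Chen–Zhang, "Finiteness of homological dimensions in
triangulated categories". -/

open CategoryTheory CategoryTheory.Limits CategoryTheory.Pretriangulated

universe v u

namespace TriFD

/-- Cast of an integer to `EReal` (= `ℤ ∪ {±∞}`, embedded in the extended reals). -/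
noncomputable def ec (n : ℤ) : EReal := ((n : ℝ) : EReal)

/-- Cast of a natural number to `EReal`. -/
noncomputable def en (n : ℕ) : EReal := ((n : ℝ) : EReal)

variable {C : Type u} [Category.{v} C] [HasZeroObject C] [HasShift C ℤ]
  [Preadditive C] [∀ n : ℤ, (shiftFunctor C n).Additive] [Pretriangulated C]

/-- `Hom(A, B) = 0`. -/
def homZero (A B : C) : Prop := ∀ f : A ⟶ B, f = 0

/-- `smd 𝒜`: the closure of `𝒜` under direct summands (retracts). -/
def smdSet (A : Set C) : Set C :=
  {X | ∃ Y ∈ A, ∃ (s : X ⟶ Y) (r : Y ⟶ X), s ≫ r = 𝟙 X}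

/-- `𝒜 ∗ ℬ`: the full subcategory of objects `Z` sitting in a distinguished triangle
`X → Z → Y → X⟦1⟧` with `X ∈ 𝒜`, `Y ∈ ℬ`. -/
def extSet (A B : Set C) : Set C :=
  {Z | ∃ (X : C) (_ : X ∈ A) (Y : C) (_ : Y ∈ B) (f : X ⟶ Z) (g : Z ⟶ Y) (h : Y ⟶ X⟦(1 : ℤ)⟧),
    Triangle.mk f g h ∈ distTriang C}

/-- The closure `add 𝒜` of `𝒜` under finite direct sums (a direct sum being witnessed by a
split distinguished triangle). -/
inductive addP (A : Set C) : C → Prop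
  | of {X : C} : X ∈ A → addP A X
  | zero {X : C} : IsZero X → addP A X
  | sum {X Z Y : C} (f : X ⟶ Z) (g : Z ⟶ Y) :
      addP A X → addP A Y → (Triangle.mk f g (0 : Y ⟶ X⟦(1 : ℤ)⟧) ∈ distTriang C) → addP A Z

/-- `add 𝒜` as a set. -/
def addSet (A : Set C) : Set C := setOf (addP A)

/-- `coprodIter 𝒜 n = coprod_{n+1}(𝒜)`, i.e. `coprod_1 = add 𝒜` and
`coprod_{n+1} = add 𝒜 ∗ coprod_n`. -/
def coprodIter (A : Set C) : ℕ → Set C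
  | 0 => addSet A
  | n + 1 => extSet (addSet A) (coprodIter A n)

/-- `Add 𝒜`: the closure of `𝒜` under arbitrary (small) coproducts. -/
def AddSet (A : Set C) : Set C :=
  {X | ∃ (ι : Type v) (f : ι → C) (_ : ∀ i, f i ∈ A) (c : Cofan f),
      Nonempty (IsColimit c) ∧ X = c.pt}

/-- `CoprodIter 𝒜 n = Coprod_{n+1}(𝒜)`, i.e. `Coprod_1 = Add 𝒜` and
`Coprod_{n+1} = Add 𝒜 ∗ Coprod_n`. -/
def CoprodIter (A : Set C) : ℕ → Set C
  | 0 => AddSet A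
  | n + 1 => extSet (AddSet A) (CoprodIter A n)

/-- `Coprod(𝒜)`: the smallest full subcategory of `C` containing `𝒜` and closed under
(small) coproducts and extensions. -/
inductive CoprodP (A : Set C) : C → Prop
  | of {X : C} : X ∈ A → CoprodP A X
  | zero {X : C} : IsZero X → CoprodP A X
  | coprod {ι : Type v} (f : ι → C) (c : Cofan f) :
      (∀ i, CoprodP A (f i)) → Nonempty (IsColimit c) → CoprodP A c.pt
  | ext {X Z Y : C} (f : X ⟶ Z) (g : Z ⟶ Y) (h : Y ⟶ X⟦(1 : ℤ)⟧) :
      CoprodP A X → CoprodP A Y → (Triangle.mk f g h ∈ distTriang C) → CoprodP A Z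

/-- `Coprod(𝒜)` as a set. -/
def CoprodSet (A : Set C) : Set C := setOf (CoprodP A)

/-- `G[p] = { G[-i] ∣ i ∈ ℤ, p i }`; e.g. `G[A,B]` corresponds to `p i = (A ≤ i ∧ i ≤ B)`. -/
def shiftsOf (G : C) (p : ℤ → Prop) : Set C := {X | ∃ i : ℤ, p i ∧ X = G⟦(-i : ℤ)⟧}

/-- `⟨G⟩^{p}_{n+1} = smd (coprod_{n+1} (G[p]))`. -/
def sClGr (G : C) (p : ℤ → Prop) (n : ℕ) : Set C := smdSet (coprodIter (shiftsOf G p) n)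

/-- `⟨G⟩^{p} = ⋃ₙ ⟨G⟩^{p}_n`; for `p = ⊤` this is `⟨G⟩`, the smallest full triangulated
subcategory of `C` containing `G` and closed under direct summands. -/
def sCl (G : C) (p : ℤ → Prop) : Set C := ⋃ n : ℕ, sClGr G p n

/-- `⟨G⟩bar^{p}_{n+1} = smd (Coprod_{n+1} (G[p]))`. -/
def bClGr (G : C) (p : ℤ → Prop) (n : ℕ) : Set C := smdSet (CoprodIter (shiftsOf G p) n)

/-- `⟨G⟩bar^{p} = smd (Coprod (G[p]))`. -/
def bCl (G : C) (p : ℤ → Prop) : Set C := smdSet (CoprodSet (shiftsOf G p))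

/-- The shift `𝒜[n]` of a subcategory (up to isomorphism). -/
def shiftSet (A : Set C) (n : ℤ) : Set C := {X | ∃ Y ∈ A, Nonempty (X ≅ Y⟦n⟧)}

/-- The finitistic dimension of the full (triangulated) subcategory of objects satisfying `P`
at an object `G`:
`fd = inf { n ∈ ℕ ∣ G(-∞,-1]^⊥ ⊆ ⟨G⟩^{[0,+∞)}[n] }` (computed among objects of `P`). -/
noncomputable def fdRel (P : Set C) (G : C) : EReal :=
  sInf {x : EReal | ∃ n : ℕ, x = en n ∧
    ∀ X ∈ P, (∀ m : ℤ, 1 ≤ m → homZero (G⟦m⟧) X) →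
      X ∈ shiftSet (sCl G (fun i => 0 ≤ i)) (n : ℤ)}

/-- The finitistic dimension `fd(C, G)` of `C` at `G`. -/
noncomputable def fd (G : C) : EReal := fdRel Set.univ G

/-- The width `w_G(P) = min { β - α ∣ P ∈ ⟨G⟩^{[α,β]} }` (junk value `0` when no such
interval exists). -/
noncomputable def width (G P : C) : ℕ :=
  sInf {d : ℕ | ∃ a b : ℤ, b - a = (d : ℤ) ∧ P ∈ sCl G (fun i => a ≤ i ∧ i ≤ b)}

/-- The big width `wbar_G(P) = min { β - α ∣ P ∈ ⟨G⟩bar^{[α,β]} }`. -/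
noncomputable def bwidth (G P : C) : ℕ :=
  sInf {d : ℕ | ∃ a b : ℤ, b - a = (d : ℤ) ∧ P ∈ bCl G (fun i => a ≤ i ∧ i ≤ b)}

/-- The lower self-orthogonal index `o⁻(G) = inf { b ≥ 0 ∣ Hom(G[i], G) = 0 for all i > b }`. -/
noncomputable def oMinus (G : C) : EReal :=
  sInf {x : EReal | ∃ b : ℕ, x = en b ∧ ∀ i : ℤ, (b : ℤ) < i → homZero (G⟦i⟧) G}

/-- The upper self-orthogonal index `o⁺(G) = inf { c ≥ 0 ∣ Hom(G, G[i]) = 0 for all i > c }`. -/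
noncomputable def oPlus (G : C) : EReal :=
  sInf {x : EReal | ∃ c : ℕ, x = en c ∧ ∀ i : ℤ, (c : ℤ) < i → homZero G (G⟦i⟧)}

/-- The aisle `C_G^{≤ n} = Coprod (G(-∞, n])` of the `t`-structure generated by the
compact object `G` (the description for general `n` agreeing, up to the canonical
identifications, with `C_G^{≤0}[-n]`). -/
def tLE (G : C) (n : ℤ) : Set C := CoprodSet (shiftsOf G (fun i => i ≤ n))

/-- The coaisle `C_G^{≥ n}` of the `t`-structure generated by the compact object `G`:
`C_G^{≥ 1} = (G(-∞,0])^⊥ = { X ∣ Hom(G⟦i⟧, X) = 0 for all i ≥ 0 }`, and in general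
`C_G^{≥ n} = { X ∣ Hom(G⟦i⟧, X) = 0 for all i ≥ 1 - n }`. -/
def tGE (G : C) (n : ℤ) : Set C := {X | ∀ i : ℤ, 1 - n ≤ i → homZero (G⟦i⟧) X}

/-- Bounded above objects `C^- = ⋃ₘ C^{≤ m}`. -/
def tMinus (G : C) : Set C := ⋃ m : ℕ, tLE G (m : ℤ)

/-- Bounded below objects `C^+ = ⋃ₘ C^{≥ -m}`. -/
def tPlus (G : C) : Set C := ⋃ m : ℕ, tGE G (-(m : ℤ))

/-- Bounded objects `C^b = C^- ∩ C^+`. -/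
def tB (G : C) : Set C := tMinus G ∩ tPlus G

/-- An object `X` is compact if `Hom(X, -)` commutes with (small) coproducts. -/
def IsCompactObj (X : C) : Prop :=
  ∀ ι : Type v, Nonempty (PreservesColimitsOfShape (Discrete ι) (coyoneda.obj (Opposite.op X)))

/-- `G` is a compact generator of `C` if `G` is compact and `C = ⟨G⟩bar^{(-∞,+∞)}`. -/
def IsCompactGenerator (G : C) : Prop :=
  IsCompactObj G ∧ ∀ X : C, X ∈ bCl G (fun _ => True)

/-- The projective dimension of `X` with respect to `G`:
`pd_G(X) = inf { n ∈ ℤ ∣ Hom(X, Y[i]) = 0 for all i > n and Y ∈ C^b ∩ C^{≤ 0} }`. -/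
noncomputable def pd (G X : C) : EReal :=
  sInf {x : EReal | ∃ n : ℤ, x = ec n ∧
    ∀ Y : C, Y ∈ tB G → Y ∈ tLE G 0 → ∀ i : ℤ, n < i → homZero X (Y⟦i⟧)}

/-- The finitistic dimension
`fpd(C, G) = sup { pd_G(X) ∣ X ∈ C^c ∩ C^b ∩ C^{≥ 0}, pd_G(X) < +∞ }`. -/
noncomputable def fpd (G : C) : EReal :=
  sSup {x : EReal | ∃ X : C,
    IsCompactObj X ∧ X ∈ tB G ∧ X ∈ tGE G 0 ∧ pd G X < ⊤ ∧ x = pd G X}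

/-- The big finitistic dimension
`Fpd(C, G) = sup { pd_G(X) ∣ X ∈ C^b ∩ C^{≥ 0}, pd_G(X) < +∞ }`. -/
noncomputable def Fpd (G : C) : EReal :=
  sSup {x : EReal | ∃ X : C, X ∈ tB G ∧ X ∈ tGE G 0 ∧ pd G X < ⊤ ∧ x = pd G X}

/-- The global dimension `gpd(C, G) = sup { pd_G(X) ∣ X ∈ C^b ∩ C^{≥ 0} }`. -/
noncomputable def gpd (G : C) : EReal :=
  sSup {x : EReal | ∃ X : C, X ∈ tB G ∧ X ∈ tGE G 0 ∧ x = pd G X}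

/-- The approximable index `b(M)` of `M ∈ C^{≤0}`: the least `n ≥ 0` such that there is a
distinguished triangle `E → M → D → E⟦1⟧` with `E ∈ ⟨G⟩bar^{[-n,n]}` and `D ∈ C^{≤ -1}`. -/
noncomputable def bIdx (G M : C) : EReal :=
  sInf {x : EReal | ∃ n : ℕ, x = en n ∧
    ∃ (E D : C) (_ : E ∈ bCl G (fun i => -(n : ℤ) ≤ i ∧ i ≤ (n : ℤ))) (_ : D ∈ tLE G (-1))
      (f : E ⟶ M) (g : M ⟶ D) (h : D ⟶ E⟦(1 : ℤ)⟧), Triangle.mk f g h ∈ distTriang C}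

/-- The `G`-approximable index `a(G) = sup { b(M) ∣ M ∈ C^{≤ 0} }`. -/
noncomputable def aIdx (G : C) : EReal :=
  sSup {x : EReal | ∃ M ∈ tLE G 0, x = bIdx G M}

/-- `C` is weakly approximable, as witnessed by the compact generator `G` (and the
`t`-structure generated by `G`, which lies in the preferred equivalence class). -/
def IsWeaklyApproximable (G : C) : Prop :=
  IsCompactGenerator G ∧ ∃ A : ℕ, 0 < A ∧
    G⟦(A : ℤ)⟧ ∈ tLE G 0 ∧
    (∀ Y ∈ tLE G 0, homZero (G⟦-(A : ℤ)⟧) Y) ∧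
    ∀ F ∈ tLE G 0, ∃ (E D : C) (_ : E ∈ bCl G (fun i => -(A : ℤ) ≤ i ∧ i ≤ (A : ℤ)))
      (_ : D ∈ tLE G (-1)) (f : E ⟶ F) (g : F ⟶ D) (h : D ⟶ E⟦(1 : ℤ)⟧),
        Triangle.mk f g h ∈ distTriang C

/-- `C` is approximable, as witnessed by the compact generator `G`. -/
def IsApproximable (G : C) : Prop :=
  IsCompactGenerator G ∧ ∃ A : ℕ, 0 < A ∧
    G⟦(A : ℤ)⟧ ∈ tLE G 0 ∧
    (∀ Y ∈ tLE G 0, homZero (G⟦-(A : ℤ)⟧) Y) ∧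
    ∀ F ∈ tLE G 0, ∃ (E D : C) (_ : E ∈ bClGr G (fun i => -(A : ℤ) ≤ i ∧ i ≤ (A : ℤ)) (A - 1))
      (_ : D ∈ tLE G (-1)) (f : E ⟶ F) (g : F ⟶ D) (h : D ⟶ E⟦(1 : ℤ)⟧),
        Triangle.mk f g h ∈ distTriang C

/-- Strongly bounded objects: `C^sb = ⋃_{i ≥ 0} ⟨G⟩bar^{[-i,i]}`. -/
def sSB (G : C) : Set C := ⋃ i : ℕ, bCl G (fun k => -(i : ℤ) ≤ k ∧ k ≤ (i : ℤ))

/-- A pair of full subcategories `(L, R)` is a `t`-structure. -/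
def IsTStructurePair (L Rt : Set C) : Prop :=
  (∀ X ∈ L, X⟦(1 : ℤ)⟧ ∈ L) ∧ (∀ X ∈ Rt, X⟦(-1 : ℤ)⟧ ∈ Rt) ∧
  (∀ X ∈ L, ∀ Y ∈ Rt, homZero X Y) ∧
  ∀ X : C, ∃ (A B : C) (_ : A ∈ L) (_ : B ∈ Rt) (f : A ⟶ X) (g : X ⟶ B) (h : B ⟶ A⟦(1 : ℤ)⟧),
    Triangle.mk f g h ∈ distTriang C

/-- `M` is a silting object: `(M[1,+∞)^⊥, M(-∞,0]^⊥)` is a `t`-structure. -/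
def IsSilting (M : C) : Prop :=
  IsTStructurePair {X | ∀ i : ℤ, 1 ≤ i → homZero (M⟦(-i : ℤ)⟧) X}
    {X | ∀ i : ℤ, i ≤ 0 → homZero (M⟦(-i : ℤ)⟧) X}

/-- `M` is a tilting object: `M` is silting and `Hom(M', M[i]) = 0` for every `i ≠ 0` and
every direct summand `M'` of a coproduct of copies of `M`. -/
def IsTilting (M : C) : Prop :=
  IsSilting M ∧ ∀ i : ℤ, i ≠ 0 → ∀ M' ∈ smdSet (AddSet {M}), homZero M' (M⟦i⟧)


/-- `⋃ₙ smd (coprodₙ 𝒜)`, so that `sCl G p = thickExt (shiftsOf G p)`. -/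
def thickExt (A : Set C) : Set C := ⋃ n : ℕ, smdSet (coprodIter A n)

lemma mem_thickExt_of_retract {A : Set C} {X Y : C} (hY : Y ∈ thickExt A)
    (s : X ⟶ Y) (r : Y ⟶ X) (hsr : s ≫ r = 𝟙 X) : X ∈ thickExt A := by
  obtain ⟨n, M, hM, s', r', h⟩ := Set.mem_iUnion.1 hY
  refine Set.mem_iUnion.2 ⟨n, M, hM, s ≫ s', r' ≫ r, ?_⟩
  rw [Category.assoc, reassoc_of% h, hsr]

lemma mem_thickExt_of_iso {A : Set C} {X Y : C} (hY : Y ∈ thickExt A) (e : X ≅ Y) :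
    X ∈ thickExt A :=
  mem_thickExt_of_retract hY e.hom e.inv e.hom_inv_id

lemma coprodIter_subset_thickExt (A : Set C) (n : ℕ) : coprodIter A n ⊆ thickExt A :=
  fun X hX => Set.mem_iUnion.2 ⟨n, X, hX, 𝟙 X, 𝟙 X, Category.id_comp _⟩

lemma subset_thickExt (A : Set C) : A ⊆ thickExt A :=
  fun _ hX => coprodIter_subset_thickExt A 0 (addP.of hX)

lemma zero_mem_thickExt (A : Set C) {X : C} (hX : IsZero X) : X ∈ thickExt A :=
  coprodIter_subset_thickExt A 0 (addP.zero hX)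

section

variable {X₁ X₂ X₃ Y₁ Y₂ Y₃ : C}
  {f : X₁ ⟶ X₂} {g : X₂ ⟶ X₃} {h : X₃ ⟶ X₁⟦(1 : ℤ)⟧}
  {f' : Y₁ ⟶ Y₂} {g' : Y₂ ⟶ Y₃} {h' : Y₃ ⟶ Y₁⟦(1 : ℤ)⟧}

lemma exists_hom₂ (hT : Triangle.mk f g h ∈ distTriang C)
    (hT₂ : Triangle.mk f' g' h' ∈ distTriang C) (a : X₁ ⟶ Y₁) (c : X₃ ⟶ Y₃)
    (comm : h ≫ a⟦(1 : ℤ)⟧' = c ≫ h') :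
    ∃ b : X₂ ⟶ Y₂, f ≫ b = a ≫ f' ∧ g ≫ c = b ≫ g' :=
  complete_distinguished_triangle_morphism₂ _ _ hT hT₂ a c comm

lemma exists_hom₃ (hT : Triangle.mk f g h ∈ distTriang C)
    (hT₂ : Triangle.mk f' g' h' ∈ distTriang C) (a : X₁ ⟶ Y₁) (b : X₂ ⟶ Y₂)
    (comm : f ≫ b = a ≫ f') :
    ∃ c : X₃ ⟶ Y₃, g ≫ c = b ≫ g' ∧ h ≫ a⟦(1 : ℤ)⟧' = c ≫ h' :=
  complete_distinguished_triangle_morphism _ _ hT hT₂ a b comm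

lemma exists_eq_comp_of_comp_mor₂ (hT : Triangle.mk f g h ∈ distTriang C) {W : C} (u : W ⟶ X₂)
    (hu : u ≫ g = 0) : ∃ v : W ⟶ X₁, u = v ≫ f :=
  Triangle.coyoneda_exact₂ _ hT u hu

lemma exists_eq_comp_of_comp_mor₃ (hT : Triangle.mk f g h ∈ distTriang C) {W : C} (u : W ⟶ X₃)
    (hu : u ≫ h = 0) : ∃ v : W ⟶ X₂, u = v ≫ g :=
  Triangle.coyoneda_exact₃ _ hT u hu

lemma exists_eq_mor₂_comp (hT : Triangle.mk f g h ∈ distTriang C) {W : C} (u : X₂ ⟶ W)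
    (hu : f ≫ u = 0) : ∃ v : X₃ ⟶ W, u = g ≫ v :=
  Triangle.yoneda_exact₂ _ hT u hu

lemma isIso_hom₂ (hT : Triangle.mk f g h ∈ distTriang C) (b : X₂ ⟶ X₂)
    (hf : f ≫ b = f) (hg : b ≫ g = g) : IsIso b := by
  let φ : Triangle.mk f g h ⟶ Triangle.mk f g h :=
    { hom₁ := 𝟙 X₁
      hom₂ := b
      hom₃ := 𝟙 X₃
      comm₁ := hf.trans (Category.id_comp f).symm
      comm₂ := (Category.comp_id g).trans hg.symm
      comm₃ := (show h ≫ (𝟙 X₁)⟦(1 : ℤ)⟧' = 𝟙 X₃ ≫ h by simp) }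
  exact isIso₂_of_isIso₁₃ φ hT hT (inferInstanceAs (IsIso (𝟙 X₁))) (inferInstanceAs (IsIso (𝟙 X₃)))

lemma isIso_hom₃ (hT : Triangle.mk f g h ∈ distTriang C) (c : X₃ ⟶ X₃)
    (hg : g ≫ c = g) (hh : c ≫ h = h) : IsIso c := by
  let φ : Triangle.mk f g h ⟶ Triangle.mk f g h :=
    { hom₁ := 𝟙 X₁
      hom₂ := 𝟙 X₂
      hom₃ := c
      comm₁ := (Category.comp_id f).trans (Category.id_comp f).symm
      comm₂ := hg.trans (Category.id_comp g).symm
      comm₃ := (show h ≫ (𝟙 X₁)⟦(1 : ℤ)⟧' = c ≫ h by simp [hh]) }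
  exact isIso₃_of_isIso₁₂ φ hT hT (inferInstanceAs (IsIso (𝟙 X₁))) (inferInstanceAs (IsIso (𝟙 X₂)))

end

/-- An extension by a retract of `M` is a retract of an extension by `M`. -/
lemma exists_retract_of_retract_right {X Z Y M : C} {f : X ⟶ Z} {g : Z ⟶ Y}
    {h : Y ⟶ X⟦(1 : ℤ)⟧} (hT : Triangle.mk f g h ∈ distTriang C)
    (s : Y ⟶ M) (r : M ⟶ Y) (hsr : s ≫ r = 𝟙 Y) :
    ∃ (Z' : C) (f' : X ⟶ Z') (g' : Z' ⟶ M) (i : Z ⟶ Z') (p : Z' ⟶ Z),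
      i ≫ p = 𝟙 Z ∧ Triangle.mk f' g' (r ≫ h) ∈ distTriang C := by
  obtain ⟨Z', f', g', hT₂⟩ := distinguished_cocone_triangle₂ (r ≫ h)
  obtain ⟨i, hi₁, hi₂⟩ := exists_hom₂ hT hT₂ (𝟙 X) s
    (by simp [reassoc_of% hsr])
  obtain ⟨p, hp₁, hp₂⟩ := exists_hom₂ hT₂ hT (𝟙 X) r (by simp)
  have := isIso_hom₂ hT (i ≫ p) (by simp [reassoc_of% hi₁, hp₁])
    (by simp [← hp₂, ← reassoc_of% hi₂, hsr])
  exact ⟨Z', f', g', i, p ≫ inv (i ≫ p), by rw [← Category.assoc, IsIso.hom_inv_id], hT₂⟩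

/-- An extension of a retract of `M` is a retract of an extension of `M`. -/
lemma exists_retract_of_retract_left {X Z Y M : C} {f : X ⟶ Z} {g : Z ⟶ Y}
    {h : Y ⟶ X⟦(1 : ℤ)⟧} (hT : Triangle.mk f g h ∈ distTriang C)
    (s : X ⟶ M) (r : M ⟶ X) (hsr : s ≫ r = 𝟙 X) :
    ∃ (Z' : C) (f' : M ⟶ Z') (g' : Z' ⟶ Y) (i : Z ⟶ Z') (p : Z' ⟶ Z),
      i ≫ p = 𝟙 Z ∧ Triangle.mk f' g' (h ≫ s⟦(1 : ℤ)⟧') ∈ distTriang C := by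
  obtain ⟨Z', f', g', hT₂⟩ := distinguished_cocone_triangle₂ (h ≫ s⟦(1 : ℤ)⟧')
  obtain ⟨i, hi₁, hi₂⟩ := exists_hom₂ hT hT₂ s (𝟙 Y) (by simp)
  obtain ⟨p, hp₁, hp₂⟩ := exists_hom₂ hT₂ hT r (𝟙 Y)
    (by simp [← Functor.map_comp, hsr])
  have := isIso_hom₂ hT (i ≫ p) (by simp [reassoc_of% hi₁, hp₁, reassoc_of% hsr])
    (by simp [← hp₂, ← hi₂])
  exact ⟨Z', f', g', i, p ≫ inv (i ≫ p), by rw [← Category.assoc, IsIso.hom_inv_id], hT₂⟩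

/-- A substitute for the associativity of `∗` which does not need the octahedral axiom: an object
`Z` of `(𝒜 ∗ ℬ) ∗ 𝒟`, built from `E ∈ 𝒜 ∗ ℬ`, is a direct summand of the sum of `E` and an
object `U` of `𝒜 ∗ (ℬ ∗ 𝒟)`. -/
lemma exists_reassociation {A E B Z D : C} {a : A ⟶ E} {b : E ⟶ B} {δ : B ⟶ A⟦(1 : ℤ)⟧}
    {z : E ⟶ Z} {c : Z ⟶ D} {l : D ⟶ E⟦(1 : ℤ)⟧}
    (hE : Triangle.mk a b δ ∈ distTriang C) (hZ : Triangle.mk z c l ∈ distTriang C) :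
    ∃ (W U : C) (j : B ⟶ W) (d : W ⟶ D) (q : D ⟶ B⟦(1 : ℤ)⟧)
      (α : A ⟶ U) (p : U ⟶ W) (κ : W ⟶ A⟦(1 : ℤ)⟧),
      Triangle.mk j d q ∈ distTriang C ∧ Triangle.mk α p κ ∈ distTriang C ∧
      ∃ (φ : Z ⟶ U) (ψ : U ⟶ Z) (k : Z ⟶ E), φ ≫ ψ + k ≫ z = 𝟙 Z := by
  obtain ⟨W, j, d, hW⟩ := distinguished_cocone_triangle₂ (l ≫ b⟦(1 : ℤ)⟧')
  have hE' : Triangle.mk δ (-a⟦(1 : ℤ)⟧') (-b⟦(1 : ℤ)⟧') ∈ distTriang C :=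
    rot_of_distTriang _ (rot_of_distTriang _ hE)
  obtain ⟨κ, hκ₁, hκ₂⟩ := exists_hom₂ hW hE' (𝟙 B) (-l) (by simp)
  obtain ⟨ν, -, hν⟩ := exists_hom₂ hZ hW b (𝟙 D) (by simp)
  simp only [Preadditive.comp_neg, neg_inj, Category.id_comp, Category.comp_id] at hκ₁ hκ₂ hν
  have hcl : c ≫ l = 0 := comp_distTriang_mor_zero₂₃ _ hZ
  have hjd : j ≫ d = 0 := comp_distTriang_mor_zero₁₂ _ hW
  obtain ⟨y, hy⟩ := exists_eq_comp_of_comp_mor₂ hE' (ν ≫ κ) (by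
    simp [← hκ₂, ← reassoc_of% hν, hcl])
  obtain ⟨U, α, p, hU⟩ := distinguished_cocone_triangle₂ κ
  have hpκ : p ≫ κ = 0 := comp_distTriang_mor_zero₂₃ _ hU
  obtain ⟨φ, hφ⟩ := exists_eq_comp_of_comp_mor₃ hU (ν - y ≫ j) (by simp [hy, hκ₁])
  obtain ⟨ψ, hψ⟩ := exists_eq_comp_of_comp_mor₃ hZ (p ≫ d) (by simp [hκ₂, reassoc_of% hpκ])
  obtain ⟨k, hk⟩ := exists_eq_comp_of_comp_mor₂ hZ (𝟙 Z - φ ≫ ψ) (by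
    simp [← hψ, ← reassoc_of% hφ, hjd, ← hν])
  exact ⟨W, U, j, d, _, α, p, κ, hW, hU, φ, ψ, k, by rw [← hk]; abel⟩

/-- The cone of `A ⟶ X ⟶ X ⊞ Y` is a direct summand of the sum of `Y` and the cone of `A ⟶ X`. -/
lemma exists_retract_cone_comp_inl {A X B : C} (Y : C) {f : A ⟶ X} {g : X ⟶ B}
    {h : B ⟶ A⟦(1 : ℤ)⟧} (hT : Triangle.mk f g h ∈ distTriang C) :
    ∃ (Q : C) (p : X ⊞ Y ⟶ Q) (w : Q ⟶ A⟦(1 : ℤ)⟧) (s : Q ⟶ B ⊞ Y) (r : B ⊞ Y ⟶ Q),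
      s ≫ r = 𝟙 Q ∧ Triangle.mk (f ≫ biprod.inl) p w ∈ distTriang C := by
  obtain ⟨Q, p, w, hQ⟩ := distinguished_cocone_triangle (f ≫ (biprod.inl : X ⟶ X ⊞ Y))
  obtain ⟨q₁, hq₁, hq₁'⟩ := exists_hom₃ hQ hT (𝟙 A) biprod.fst
    (by simp)
  obtain ⟨q₂, hq₂⟩ := exists_eq_mor₂_comp hQ (biprod.snd : X ⊞ Y ⟶ Y) (by simp)
  obtain ⟨b, hb, hb'⟩ := exists_hom₃ hT hQ (𝟙 A) biprod.inl
    (by simp)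
  simp only [CategoryTheory.Functor.map_id, Category.comp_id] at hq₁' hb'
  have hpw : p ≫ w = 0 := comp_distTriang_mor_zero₂₃ _ hQ
  let e : Q ⟶ Q := q₁ ≫ b + q₂ ≫ biprod.inr ≫ p
  have : IsIso e := by
    refine isIso_hom₃ hQ e ?_ (by simp [e, hpw, ← hb', ← hq₁'])
    simp only [e, Preadditive.comp_add, reassoc_of% hq₁, hb, ← reassoc_of% hq₂]
    rw [← Category.assoc, ← Category.assoc, ← Preadditive.add_comp, biprod.total, Category.id_comp]
  refine ⟨Q, p, w, biprod.lift q₁ q₂, biprod.desc b (biprod.inr ≫ p) ≫ inv e, ?_, hQ⟩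
  rw [← Category.assoc, biprod.lift_desc]
  exact IsIso.hom_inv_id e

lemma extSet_addSet_thickExt_subset (A : Set C) :
    extSet (addSet A) (thickExt A) ⊆ thickExt A := by
  rintro Z ⟨X, hX, Y, hY, f, g, h, hT⟩
  obtain ⟨n, M, hM, s, r, hsr⟩ := Set.mem_iUnion.1 hY
  obtain ⟨Z', f', g', i, p, hip, hT₂⟩ := exists_retract_of_retract_right hT s r hsr
  exact mem_thickExt_of_retract (coprodIter_subset_thickExt A (n + 1)
    ⟨X, hX, M, hM, f', g', _, hT₂⟩) i p hip

lemma extSet_coprodIter_thickExt_subset (A : Set C) (n : ℕ) :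
    extSet (coprodIter A n) (thickExt A) ⊆ thickExt A := by
  induction n with
  | zero => exact extSet_addSet_thickExt_subset A
  | succ n ih =>
    rintro Z ⟨E, ⟨X, hX, B, hB, a, b, δ, hE⟩, D, hD, z, c, l, hZ⟩
    obtain ⟨W, U, j, d, q, α, p, κ, hW, hU, φ, ψ, k, hk⟩ := exists_reassociation hE hZ
    have hU' : U ∈ thickExt A := extSet_addSet_thickExt_subset A
      ⟨X, hX, W, ih ⟨B, hB, D, hD, j, d, q, hW⟩, α, p, κ, hU⟩
    obtain ⟨Q, p', w, s, r, hsr, hQ⟩ := exists_retract_cone_comp_inl U hE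
    have hQ' : Q ∈ thickExt A := mem_thickExt_of_retract
      (ih ⟨B, hB, U, hU', _, _, _, binaryBiproductTriangle_distinguished B U⟩) s r hsr
    refine mem_thickExt_of_retract (extSet_addSet_thickExt_subset A
      ⟨X, hX, Q, hQ', _, p', w, hQ⟩) (biprod.lift k φ) (biprod.desc z ψ) ?_
    rw [biprod.lift_desc, add_comm, hk]

/-- `thickExt 𝒜` is closed under extensions, even without the octahedral axiom. -/
lemma extSet_thickExt_subset (A : Set C) :
    extSet (thickExt A) (thickExt A) ⊆ thickExt A := by
  rintro Z ⟨X, hX, Y, hY, f, g, h, hT⟩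
  obtain ⟨n, M, hM, s, r, hsr⟩ := Set.mem_iUnion.1 hX
  obtain ⟨Z', f', g', i, p, hip, hT₂⟩ := exists_retract_of_retract_left hT s r hsr
  exact mem_thickExt_of_retract (extSet_coprodIter_thickExt_subset A n
    ⟨M, hM, Y, hY, f', g', _, hT₂⟩) i p hip

/-- `thickExt 𝒜` is contained in every class containing `𝒜` and the zero objects and closed
under extensions and retracts. -/
lemma thickExt_subset {A P : Set C} (hA : A ⊆ P) (hzero : ∀ X, IsZero X → X ∈ P)
    (hext : extSet P P ⊆ P) (hsmd : smdSet P ⊆ P) : thickExt A ⊆ P := by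
  have hadd : addSet A ⊆ P := by
    intro X hX
    induction hX with
    | of h => exact hA h
    | zero h => exact hzero _ h
    | sum f g _ _ hT h₁ h₂ => exact hext ⟨_, h₁, _, h₂, f, g, _, hT⟩
  have hcop (n : ℕ) : coprodIter A n ⊆ P := by
    induction n with
    | zero => exact hadd
    | succ n ih =>
      rintro Z ⟨X, hX, Y, hY, f, g, h, hT⟩
      exact hext ⟨X, hadd hX, Y, ih hY, f, g, h, hT⟩
  intro X hX
  obtain ⟨n, M, hM, s, r, hsr⟩ := Set.mem_iUnion.1 hX
  exact hsmd ⟨M, hcop n hM, s, r, hsr⟩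

lemma thickExt_mono {A B : Set C} (h : A ⊆ B) : thickExt A ⊆ thickExt B :=
  thickExt_subset (h.trans (subset_thickExt B)) (fun _ => zero_mem_thickExt B)
    (extSet_thickExt_subset B) (fun _ ⟨_, hY, s, r, hsr⟩ => mem_thickExt_of_retract hY s r hsr)

lemma sCl_mono (G : C) {p q : ℤ → Prop} (h : ∀ i, p i → q i) : sCl G p ⊆ sCl G q :=
  thickExt_mono fun _ ⟨i, hi, hX⟩ => ⟨i, h i hi, hX⟩

/-- The shift by `n` maps `⟨G⟩^p` into `⟨G⟩^q` when `q` is `p` translated by `-n`. -/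
lemma shift_mem_sCl {G : C} {p q : ℤ → Prop} (n : ℤ) (hpq : ∀ i, p i → q (i - n)) {X : C}
    (hX : X ∈ sCl G p) : X⟦n⟧ ∈ sCl G q := by
  refine thickExt_subset (P := {X | X⟦n⟧ ∈ sCl G q}) ?_ ?_ ?_ ?_ hX
  · rintro _ ⟨i, hi, rfl⟩
    exact mem_thickExt_of_iso (subset_thickExt _ ⟨i - n, hpq i hi, rfl⟩)
      ((shiftFunctorAdd' C (-i) n (-(i - n)) (by lia)).symm.app G)
  · exact fun X hX => zero_mem_thickExt _ ((shiftFunctor C n).map_isZero hX)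
  · rintro Z ⟨X, hX, Y, hY, f, g, h, hT⟩
    exact extSet_thickExt_subset _ ⟨_, hX, _, hY, _, _, _, Triangle.shift_distinguished _ hT n⟩
  · rintro X ⟨Y, hY, s, r, hsr⟩
    exact mem_thickExt_of_retract hY (s⟦n⟧') (r⟦n⟧') (by rw [← Functor.map_comp, hsr]; simp)

/-- A triangle functor sending `G` into `⟨H⟩^{[a,+∞)}` sends `⟨G⟩^{[0,+∞)}` into
`⟨H⟩^{[a,+∞)}`. -/
lemma map_mem_sCl {D : Type*} [Category* D] [HasZeroObject D] [HasShift D ℤ]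
    [Preadditive D] [∀ n : ℤ, (shiftFunctor D n).Additive] [Pretriangulated D]
    (F : C ⥤ D) [F.CommShift ℤ] [F.IsTriangulated] {G : C} {H : D} {a : ℤ}
    (hG : F.obj G ∈ sCl H (fun i => a ≤ i)) {X : C} (hX : X ∈ sCl G (fun i => 0 ≤ i)) :
    F.obj X ∈ sCl H (fun i => a ≤ i) := by
  refine thickExt_subset (P := {X | F.obj X ∈ sCl H (fun i => a ≤ i)}) ?_ ?_ ?_ ?_ hX
  · rintro _ ⟨i, hi, rfl⟩
    exact mem_thickExt_of_iso (shift_mem_sCl (-i) (fun k hk => by lia) hG)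
      ((F.commShiftIso (-i)).app G)
  · exact fun X hX => zero_mem_thickExt _ (F.map_isZero hX)
  · rintro Z ⟨X, hX, Y, hY, f, g, h, hT⟩
    exact extSet_thickExt_subset _ ⟨_, hX, _, hY, _, _, _, F.map_distinguished _ hT⟩
  · rintro X ⟨Y, hY, s, r, hsr⟩
    exact mem_thickExt_of_retract hY (F.map s) (F.map r) (by rw [← F.map_comp, hsr]; simp)

lemma exists_mem_sCl_Icc {G X : C} (hX : X ∈ sCl G (fun _ => True)) :
    ∃ N : ℕ, X ∈ sCl G (fun i => -(N : ℤ) ≤ i ∧ i ≤ N) := by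
  refine thickExt_subset (P := {X | ∃ N : ℕ, X ∈ sCl G (fun i => -(N : ℤ) ≤ i ∧ i ≤ N)})
    ?_ ?_ ?_ ?_ hX
  · rintro _ ⟨i, -, rfl⟩
    exact ⟨i.natAbs, subset_thickExt _ ⟨i, by lia, rfl⟩⟩
  · exact fun X hX => ⟨0, zero_mem_thickExt _ hX⟩
  · rintro Z ⟨X, ⟨N, hX⟩, Y, ⟨N', hY⟩, f, g, h, hT⟩
    exact ⟨max N N', extSet_thickExt_subset _ ⟨X, sCl_mono G (fun i hi => by lia) hX,
      Y, sCl_mono G (fun i hi => by lia) hY, f, g, h, hT⟩⟩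
  · rintro X ⟨Y, ⟨N, hY⟩, s, r, hsr⟩
    exact ⟨N, mem_thickExt_of_retract hY s r hsr⟩

/-- The width is attained. -/
lemma exists_mem_sCl_width {G P : C} (hP : P ∈ sCl G (fun _ => True)) :
    ∃ a b : ℤ, b - a = width G P ∧ P ∈ sCl G (fun i => a ≤ i ∧ i ≤ b) := by
  obtain ⟨N, hN⟩ := exists_mem_sCl_Icc hP
  exact Nat.sInf_mem (s := {d : ℕ | ∃ a b : ℤ, b - a = (d : ℤ) ∧
    P ∈ sCl G (fun i => a ≤ i ∧ i ≤ b)}) ⟨2 * N, -N, N, by lia, hN⟩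

lemma homZero_shift_iff {D : Type*} [Category* D] [HasShift D ℤ] [Preadditive D]
    [∀ n : ℤ, (shiftFunctor D n).Additive] (X Y : D) (m n : ℤ) :
    homZero (X⟦m⟧) (Y⟦n⟧) ↔ homZero X (Y⟦n - m⟧) := by
  let e : Y⟦n - m⟧⟦m⟧ ≅ Y⟦n⟧ := (shiftFunctorAdd' D (n - m) m n (by lia)).symm.app Y
  constructor
  · intro h f
    apply (shiftFunctor D m).map_injective
    rw [Functor.map_zero, ← cancel_mono e.hom, zero_comp]
    exact h _
  · intro h f
    obtain ⟨g, hg⟩ := (shiftFunctor D m).map_surjective (f ≫ e.inv)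
    rw [← cancel_mono e.inv, zero_comp, ← hg, h g, Functor.map_zero]

/-- If `Hom(G⟦m⟧, X) = 0` for `m ≥ 1` and `P ∈ ⟨G⟩^{[a,b]}`, then `Hom(P⟦m⟧, X⟦-b⟧) = 0` for
`m ≥ 1`. -/
lemma homZero_shift_of_mem_sCl {G P X : C} {a b : ℤ}
    (hP : P ∈ sCl G (fun i => a ≤ i ∧ i ≤ b)) (hX : ∀ m : ℤ, 1 ≤ m → homZero (G⟦m⟧) X)
    {m : ℤ} (hm : 1 ≤ m) : homZero (P⟦m⟧) (X⟦-b⟧) := by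
  rw [homZero_shift_iff]
  refine thickExt_subset (P := {P | homZero P (X⟦-b - m⟧)}) ?_ ?_ ?_ ?_ hP
  · rintro _ ⟨i, hi, rfl⟩
    have h := hX (b + m - i) (by lia)
    refine (homZero_shift_iff _ _ _ _).2 ?_
    have h' : homZero (G⟦b + m - i⟧) (X⟦(0 : ℤ)⟧) := fun f => by
      rw [← cancel_mono ((shiftFunctorZero C ℤ).hom.app X), zero_comp]
      exact h _
    have := (homZero_shift_iff _ _ _ _).1 h'
    rwa [show -b - m - -i = 0 - (b + m - i) by lia]
  · exact fun Y hY f => hY.eq_of_src f 0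
  · rintro Z ⟨Y, hY, Y', hY', f, g, h, hT⟩ u
    obtain ⟨v, rfl⟩ := exists_eq_mor₂_comp hT u (hY _)
    rw [hY' v, comp_zero]
  · rintro Y ⟨Y', hY', s, r, hsr⟩ u
    rw [← Category.id_comp u, ← hsr, Category.assoc, hY' (r ≫ u), comp_zero]

/-- The vanishing of morphisms between shifts transfers along an adjunction of triangle
functors. -/
lemma homZero_shift_map_of_adjunction {D : Type*} [Category* D] [HasZeroObject D] [HasShift D ℤ]
    [Preadditive D] [∀ n : ℤ, (shiftFunctor D n).Additive] [Pretriangulated D]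
    {F : C ⥤ D} {H : D ⥤ C} [F.CommShift ℤ] [H.CommShift ℤ] [F.IsTriangulated]
    (adj : F ⊣ H) {G : C} {X : D} {m n : ℤ} (h : homZero ((F.obj G)⟦m⟧) (X⟦n⟧)) :
    homZero (G⟦m⟧) ((H.obj X)⟦n⟧) := by
  intro f
  rw [← cancel_mono ((H.commShiftIso n).inv.app X), zero_comp]
  apply (adj.homEquiv _ _).symm.injective
  rw [← cancel_epi ((F.commShiftIso m).inv.app G)]
  exact (h _).trans (h _).symm

/-- Theorem 1.2(2): the finitistic dimension of the left term of a left
recollement is bounded by that of the middle term. -/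
theorem stmt1
    {R : Type u} [Category.{v} R] [HasZeroObject R] [HasShift R ℤ]
    [Preadditive R] [∀ n : ℤ, (shiftFunctor R n).Additive] [Pretriangulated R]
    {S : Type u} [Category.{v} S] [HasZeroObject S] [HasShift S ℤ]
    [Preadditive S] [∀ n : ℤ, (shiftFunctor S n).Additive] [Pretriangulated S]
    {T : Type u} [Category.{v} T] [HasZeroObject T] [HasShift T ℤ]
    [Preadditive T] [∀ n : ℤ, (shiftFunctor T n).Additive] [Pretriangulated T]
    (iStar : S ⥤ R) (iLower : R ⥤ S) (jLower : T ⥤ S) (jStar : S ⥤ T)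
    [iStar.CommShift ℤ] [iStar.IsTriangulated]
    [iLower.CommShift ℤ] [iLower.IsTriangulated]
    [jLower.CommShift ℤ] [jLower.IsTriangulated]
    [jStar.CommShift ℤ] [jStar.IsTriangulated]
    (adjI : iStar ⊣ iLower) (adjJ : jLower ⊣ jStar)
    [iLower.Full] [iLower.Faithful] [jLower.Full] [jLower.Faithful]
    (hJI : ∀ X : R, IsZero (jStar.obj (iLower.obj X)))
    (hglue : ∀ Y : S, ∃ h : iLower.obj (iStar.obj Y) ⟶ (jLower.obj (jStar.obj Y))⟦(1 : ℤ)⟧,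
      Triangle.mk (adjJ.counit.app Y) (adjI.unit.app Y) h ∈ distTriang S)
    (G_R : R) (G_S : S)
    (hiG : iStar.obj G_S ∈ sCl G_R (fun _ => True)) :
    fd G_R ≤ fd G_S + en (width G_R (iStar.obj G_S)) ∧
      (fd G_S < ⊤ → fd G_R < ⊤) := by
  obtain ⟨a, b, hab, hw⟩ := exists_mem_sCl_width hiG
  set w := width G_R (iStar.obj G_S)
  have key (n : ℕ)
      (hn : ∀ X ∈ (Set.univ : Set S), (∀ m : ℤ, 1 ≤ m → homZero (G_S⟦m⟧) X) →
        X ∈ shiftSet (sCl G_S (fun i => 0 ≤ i)) (n : ℤ)) :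
      fd G_R ≤ en n + en w := by
    have hsum : en n + en w = en (n + w) := by simp [en]
    rw [hsum]
    refine sInf_le ⟨n + w, rfl, fun X _ hX => ?_⟩
    obtain ⟨Y, hY, ⟨e⟩⟩ := hn ((iLower.obj X)⟦-b⟧) trivial fun m hm =>
      homZero_shift_map_of_adjunction adjI (homZero_shift_of_mem_sCl hw hX hm)
    refine ⟨(iStar.obj Y)⟦a⟧, shift_mem_sCl a (fun i hi => by lia)
      (map_mem_sCl iStar (sCl_mono G_R (fun i hi => hi.1) hw) hY), ⟨?_⟩⟩
    have e₁ : X⟦-b⟧ ≅ (iStar.obj Y)⟦(n : ℤ)⟧ :=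
      (shiftFunctor R (-b)).mapIso (asIso (adjI.counit.app X)).symm ≪≫
        ((iStar.commShiftIso (-b)).app (iLower.obj X)).symm ≪≫ iStar.mapIso e ≪≫
          (iStar.commShiftIso (n : ℤ)).app Y
    exact (shiftFunctorCompIsoId R (-b) b (by lia)).symm.app X ≪≫
      (shiftFunctor R b).mapIso e₁ ≪≫
        (shiftFunctorAdd' R (n : ℤ) b (n + b) rfl).symm.app _ ≪≫
          (shiftFunctorAdd' R a ((n + w : ℕ) : ℤ) (n + b) (by push_cast; lia)).app _
  have hle : fd G_R ≤ fd G_S + en w := by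
    by_cases hS : ∃ n : ℕ, ∀ X ∈ (Set.univ : Set S), (∀ m : ℤ, 1 ≤ m → homZero (G_S⟦m⟧) X) →
        X ∈ shiftSet (sCl G_S (fun i => 0 ≤ i)) (n : ℤ)
    · classical
      refine (key (Nat.find hS) (Nat.find_spec hS)).trans (add_le_add_left (le_sInf ?_) _)
      rintro _ ⟨n, rfl, hn⟩
      exact EReal.coe_le_coe_iff.2 (Nat.cast_le.2 (Nat.find_min' hS hn))
    · have : fd G_S = ⊤ := by
        refine sInf_eq_top.2 ?_
        rintro _ ⟨n, rfl, hn⟩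
        exact absurd ⟨n, hn⟩ hS
      rw [this, EReal.top_add_of_ne_bot (show en w ≠ ⊥ from EReal.coe_ne_bot _)]
      exact le_top
  exact ⟨hle, fun h => hle.trans_lt (EReal.add_lt_top h.ne (EReal.coe_ne_top _))⟩


end TriFD
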